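/- Let 2 ≤ m ≤ n, and let A be an m×n matrix with nonnegative real entries whose maximum entry is α. If ‖A‖₁ ≥ n·α, then E(A) ≤ ‖A‖₁/√(mn) + √((m−1)·(α·‖A‖₁ − ‖A‖₁²/(mn))). -/

import Mathlib

open Matrix

/-- The singular values of a real `m × n` matrix `A`, listed in decreasing order:
`singularValues A i` is the `i`-th largest square root of an eigenvalue of `A * Aᵀ`
(over `ℝ`, `Aᴴ = Aᵀ`). -/
noncomputable def singularValues {m n : ℕ} (A : Matrix (Fin m) (Fin n) ℝ) : Fin m → ℝ :=
  fun i =>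
    Real.sqrt ((Matrix.isHermitian_mul_conjTranspose_self A).eigenvalues
      (Tuple.sort (Matrix.isHermitian_mul_conjTranspose_self A).eigenvalues i.rev))

/-- The energy of a matrix: the sum of its singular values. -/
noncomputable def energy {m n : ℕ} (A : Matrix (Fin m) (Fin n) ℝ) : ℝ :=
  ∑ i, singularValues A i

/-- The entrywise ℓ¹-norm of a matrix: the sum of the absolute values of its entries. -/
noncomputable def norm1 {m n : ℕ} (A : Matrix (Fin m) (Fin n) ℝ) : ℝ :=
  ∑ i, ∑ j, |A i j|

/-- The Rayleigh quotient bound: the quadratic form of a symmetric real matrix is at most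
any upper bound of its eigenvalues times the squared length. -/
lemma Matrix.IsHermitian.dotProduct_mulVec_le {ι : Type*} [Fintype ι] [DecidableEq ι]
    {M : Matrix ι ι ℝ} (hM : M.IsHermitian) {c : ℝ} (hc : ∀ i, hM.eigenvalues i ≤ c)
    (x : ι → ℝ) : x ⬝ᵥ (M *ᵥ x) ≤ c * (x ⬝ᵥ x) := by
  have key (y : ι → ℝ) : x ⬝ᵥ y = ∑ i, (x ⬝ᵥ ⇑(hM.eigenvectorBasis i)) *
      (⇑(hM.eigenvectorBasis i) ⬝ᵥ y) := by
    have h := hM.eigenvectorBasis.sum_inner_mul_inner (WithLp.toLp 2 x) (WithLp.toLp 2 y)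
    simpa [EuclideanSpace.inner_eq_star_dotProduct, dotProduct_comm] using h.symm
  have hT : Mᵀ = M := by simpa [conjTranspose_eq_transpose_of_trivial] using hM.eq
  rw [key (M *ᵥ x), key x, Finset.mul_sum]
  refine Finset.sum_le_sum fun i _ => ?_
  have h : ⇑(hM.eigenvectorBasis i) ⬝ᵥ (M *ᵥ x) =
      hM.eigenvalues i * (x ⬝ᵥ ⇑(hM.eigenvectorBasis i)) := by
    rw [dotProduct_mulVec, ← mulVec_transpose, hT, hM.mulVec_eigenvectorBasis, smul_dotProduct,
      dotProduct_comm, smul_eq_mul]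
  rw [h, dotProduct_comm _ x]
  nlinarith [mul_le_mul_of_nonneg_right (hc i)
    (mul_self_nonneg (x ⬝ᵥ ⇑(hM.eigenvectorBasis i)))]

/-- `x + √(k * (T - x ^ 2))` is antitone in `x ≥ √(T / (k + 1))`; the square root at the larger
point `a` is replaced by any `r` with `r ^ 2 ≤ k * (T - a ^ 2)`. -/
lemma add_le_add_sqrt_of_sq_le {k T t a r : ℝ} (hk : 0 < k) (ht : 0 ≤ t) (hta : t ≤ a)
    (hT : T ≤ (k + 1) * t ^ 2) (hra : r ^ 2 ≤ k * (T - a ^ 2)) :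
    a + r ≤ t + √(k * (T - t ^ 2)) := by
  have hat : t ^ 2 ≤ a ^ 2 := by gcongr
  have hle : r ^ 2 ≤ k * (T - t ^ 2) := hra.trans (by gcongr)
  have hs := Real.sq_sqrt ((sq_nonneg r).trans hle)
  have hrs := Real.le_sqrt_of_sq_le hle
  set s := √(k * (T - t ^ 2))
  have hskt : s ≤ k * t := by
    refine le_of_sq_le_sq ?_ (by positivity)
    rw [hs]
    nlinarith [mul_le_mul_of_nonneg_left hT hk.le]
  by_contra! hlt
  have hsum : s + r ≤ k * (a + t) := by nlinarith [mul_le_mul_of_nonneg_left hta hk.le]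
  have hdiff : k * (a + t) * (a - t) ≤ (s - r) * (s + r) := by nlinarith
  have hmul := mul_le_mul_of_nonneg_left hsum (sub_nonneg.2 hrs)
  have hpos : 0 < k * (a + t) := mul_pos hk (by linarith)
  nlinarith

/-- The energy is the sum of the square roots of the eigenvalues, in any order. -/
lemma energy_eq_sum_sqrt_eigenvalues {m n : ℕ} (A : Matrix (Fin m) (Fin n) ℝ) :
    energy A = ∑ i, √((isHermitian_mul_conjTranspose_self A).eigenvalues i) := by
  unfold energy singularValues
  exact Equiv.sum_comp (Fin.revPerm.trans
    (Tuple.sort (isHermitian_mul_conjTranspose_self A).eigenvalues))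
    fun i => √((isHermitian_mul_conjTranspose_self A).eigenvalues i)

/-- The eigenvalues of `A * Aᵀ` add up to the squared Frobenius norm of `A`. -/
lemma sum_eigenvalues_mul_conjTranspose_self {m n : ℕ} (A : Matrix (Fin m) (Fin n) ℝ) :
    ∑ i, (isHermitian_mul_conjTranspose_self A).eigenvalues i = ∑ i, ∑ j, A i j ^ 2 := by
  have h := (isHermitian_mul_conjTranspose_self A).trace_eq_sum_eigenvalues
  simp only [RCLike.ofReal_real_eq_id, id] at h
  rw [← h]
  simp [Matrix.trace, Matrix.mul_apply, sq]

/-- The squared sum of all entries is at most `m * n` times any bound on the eigenvalues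
of `A * Aᵀ`. -/
lemma sq_sum_le_of_eigenvalues_le {m n : ℕ} (A : Matrix (Fin m) (Fin n) ℝ) {c : ℝ}
    (hc : ∀ i, (isHermitian_mul_conjTranspose_self A).eigenvalues i ≤ c) :
    (∑ i, ∑ j, A i j) ^ 2 ≤ m * n * c := by
  have h := (isHermitian_mul_conjTranspose_self A).dotProduct_mulVec_le hc 1
  have hquad : (1 : Fin m → ℝ) ⬝ᵥ ((A * Aᴴ) *ᵥ 1) = ∑ j, (∑ i, A i j) ^ 2 := by
    rw [← mulVec_mulVec, dotProduct_mulVec]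
    simp [dotProduct, vecMul, mulVec, sq]
  have hone : (1 : Fin m → ℝ) ⬝ᵥ 1 = m := by simp
  rw [hquad, hone] at h
  have hcs := sq_sum_le_card_mul_sum_sq (s := Finset.univ) (f := fun j => ∑ i, A i j)
  rw [Finset.card_univ, Fintype.card_fin, Finset.sum_comm] at hcs
  nlinarith [mul_le_mul_of_nonneg_left h (Nat.cast_nonneg (α := ℝ) n)]

/-- If `2 ≤ m ≤ n` and `A` is an `m × n` nonnegative real matrix with
maximum entry `α` satisfying `‖A‖₁ ≥ n·α`, then
`E(A) ≤ ‖A‖₁/√(mn) + √((m-1)·(α·‖A‖₁ - ‖A‖₁²/(mn)))`. -/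
theorem energy_le_of_norm1_ge' {m n : ℕ} (hm : 2 ≤ m) (hmn : m ≤ n)
    (A : Matrix (Fin m) (Fin n) ℝ) (α : ℝ)
    (hnonneg : ∀ i j, 0 ≤ A i j) (hmax_le : ∀ i j, A i j ≤ α)
    (hmax_ex : ∃ i j, A i j = α) (h1 : (n : ℝ) * α ≤ norm1 A) :
    energy A ≤ norm1 A / Real.sqrt (m * n) +
      Real.sqrt (((m : ℝ) - 1) * (α * norm1 A - (norm1 A) ^ 2 / (m * n))) := by
  have hS : norm1 A = ∑ i, ∑ j, A i j := by simp [norm1, abs_of_nonneg (hnonneg _ _)]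
  have hS0 : 0 ≤ norm1 A := by unfold norm1; positivity
  have hm0 : (2 : ℝ) ≤ m := by exact_mod_cast hm
  have hn0 : (2 : ℝ) ≤ n := by exact_mod_cast hm.trans hmn
  have : Nonempty (Fin m) := ⟨⟨0, by lia⟩⟩
  rw [energy_eq_sum_sqrt_eigenvalues]
  have hnn := (posSemidef_self_mul_conjTranspose A).eigenvalues_nonneg
  have htr := sum_eigenvalues_mul_conjTranspose_self A
  have hray := fun c => sq_sum_le_of_eigenvalues_le A (c := c)
  set ev := (isHermitian_mul_conjTranspose_self A).eigenvalues
  obtain ⟨k, hk⟩ := Finite.exists_max ev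
  have hfrob : ∑ i, ev i ≤ α * norm1 A := by
    rw [htr, hS]
    simp only [Finset.mul_sum]
    gcongr with i _ j _
    nlinarith [mul_le_mul_of_nonneg_right (hmax_le i j) (hnonneg i j)]
  have hk1 := hray _ hk
  rw [← hS] at hk1
  have hsq : (norm1 A / √(m * n)) ^ 2 = norm1 A ^ 2 / (m * n) := by
    rw [div_pow, Real.sq_sqrt (by positivity)]
  rw [← hsq, ← Finset.add_sum_erase _ _ (Finset.mem_univ k)]
  rw [← Finset.add_sum_erase _ _ (Finset.mem_univ k)] at hfrob
  have hcard : ((Finset.univ.erase k).card : ℝ) = m - 1 := by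
    rw [Finset.card_erase_of_mem (Finset.mem_univ k), Finset.card_univ, Fintype.card_fin,
      Nat.cast_sub (by lia), Nat.cast_one]
  apply add_le_add_sqrt_of_sq_le
  · linarith
  · positivity
  · apply Real.le_sqrt_of_sq_le
    rw [hsq, div_le_iff₀ (by positivity)]
    linarith
  · rw [hsq, sub_add_cancel, ← mul_div_assoc, mul_div_mul_left _ _ (by positivity),
      le_div_iff₀ (by positivity)]
    nlinarith [mul_le_mul_of_nonneg_right h1 hS0]
  · refine sq_sum_le_card_mul_sum_sq.trans ?_
    rw [hcard]
    simp only [Real.sq_sqrt (hnn _)]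
    gcongr
    · linarith
    · linarith
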